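/- arXiv:2605.13691 — 4 statements merged into one kernel-verified Lean document; each statement's English description precedes it below -/
import Mathlib

section
/- Let n ≥ 1 and let λ₁, …, λₙ be pairwise distinct real numbers with λ₁ + ⋯ + λₙ = 1. Then ∑_{i=1}^{n} λᵢ^{n+1} / ∏_{j ≠ i} (λᵢ − λⱼ) = (1 + ∑_{i=1}^{n} λᵢ²) / 2. -/
open Finset

lemma S_one (n : ℕ) (lam : Fin n → ℝ) (hdist : Function.Injective lam) (s : Finset (Fin n))
    (m : ℕ) (hm : s.card = m + 1) :
    ∑ i ∈ s, lam i ^ m / ∏ j ∈ s.erase i, (lam i - lam j) = 1 := by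
  have h := Lagrange.leadingCoeff_eq_sum (s := s) (v := lam) (P := (Polynomial.X ^ m : Polynomial ℝ))
    hdist.injOn (by simp [hm])
  simpa using h.symm

lemma S_rec (n : ℕ) (lam : Fin n → ℝ) (hdist : Function.Injective lam) (s : Finset (Fin n))
    (a : Fin n) (ha : a ∉ s) (k : ℕ) :
    ∑ i ∈ insert a s, lam i ^ (k + 1) / ∏ j ∈ (insert a s).erase i, (lam i - lam j)
      = lam a * ∑ i ∈ insert a s, lam i ^ k / ∏ j ∈ (insert a s).erase i, (lam i - lam j)
        + ∑ i ∈ s, lam i ^ k / ∏ j ∈ s.erase i, (lam i - lam j) := by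
  rw [sum_insert ha, sum_insert ha, mul_add, mul_sum, add_assoc, ← sum_add_distrib]
  congr 1
  · ring
  · refine sum_congr rfl fun i hi => ?_
    have hia : i ≠ a := fun h => ha (h ▸ hi)
    have hne : lam i - lam a ≠ 0 := sub_ne_zero.2 fun h => hia (hdist h)
    have hP : ∏ j ∈ s.erase i, (lam i - lam j) ≠ 0 := by
      refine prod_ne_zero_iff.2 fun j hj => sub_ne_zero.2 fun h => ?_
      exact (mem_erase.1 hj).1 (hdist h).symm
    rw [erase_insert_of_ne hia.symm, prod_insert (fun h => ha (mem_of_mem_erase h))]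
    field_simp
    ring

lemma S_main (n : ℕ) (lam : Fin n → ℝ) (hdist : Function.Injective lam) (s : Finset (Fin n)) :
    ∑ i ∈ s, lam i ^ s.card / ∏ j ∈ s.erase i, (lam i - lam j) = ∑ i ∈ s, lam i ∧
    ∑ i ∈ s, lam i ^ (s.card + 1) / ∏ j ∈ s.erase i, (lam i - lam j)
      = ((∑ i ∈ s, lam i) ^ 2 + ∑ i ∈ s, lam i ^ 2) / 2 := by
  induction s using Finset.induction_on with
  | empty => simp
  | insert a s ha ih =>
    have h1 := S_one n lam hdist (insert a s) s.card (card_insert_of_notMem ha)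
    rw [card_insert_of_notMem ha, S_rec n lam hdist s a ha (s.card + 1),
      S_rec n lam hdist s a ha s.card, h1, ih.1, ih.2, sum_insert ha, sum_insert ha]
    constructor <;> ring



/-- For `n ≥ 1` pairwise distinct real numbers `λ₁, …, λₙ` summing to `1`,
`∑ i, λᵢ^(n+1) / ∏_{j ≠ i} (λᵢ - λⱼ) = (1 + ∑ i, λᵢ²) / 2`. -/
theorem stmt_0 (n : ℕ) (hn : 1 ≤ n) (lam : Fin n → ℝ)
    (hdist : Function.Injective lam) (hsum : ∑ i, lam i = 1) :
    ∑ i, lam i ^ (n + 1) / ∏ j ∈ Finset.univ.erase i, (lam i - lam j)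
      = (1 + ∑ i, (lam i) ^ 2) / 2 := by
  have h := (S_main n lam hdist univ).2
  simpa [hsum] using h
end

section
/- Let n ≥ 1 and let 𝒟 be the set of n×n complex density matrices, i.e., Hermitian positive semidefinite matrices of trace 1. The function Q₂(ρ) = log(2 / (1 + Tr(ρ²))) is strictly concave on 𝒟: for all ρ₀, ρ₁ ∈ 𝒟 with ρ₀ ≠ ρ₁ and all t ∈ (0,1), Q₂((1−t)ρ₀ + t ρ₁) > (1−t) Q₂(ρ₀) + t Q₂(ρ₁). -/
open Matrix
open scoped ComplexOrder

/-- The averaged accessible information `Q₂(ρ) = log(2 / (1 + Tr ρ²))`. -/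
noncomputable def Q2 {n : ℕ} (ρ : Matrix (Fin n) (Fin n) ℂ) : ℝ :=
  Real.log (2 / (1 + ((ρ * ρ).trace).re))

lemma aux_trace_le {n : ℕ} (ρ : Matrix (Fin n) (Fin n) ℂ) (h : ρ.PosSemidef)
    (htr : ρ.trace = 1) : ((ρ * ρ).trace).re ≤ 1 := by
  have key : (ρ * ρ).trace ≤ ρ.trace * ρ.trace := by
    simp only [Matrix.trace, Matrix.diag, Matrix.mul_apply, Finset.sum_mul_sum]
    refine Finset.sum_le_sum fun i _ => Finset.sum_le_sum fun j _ => ?_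
    have := (h.submatrix ![i, j]).det_nonneg
    rw [Matrix.det_fin_two] at this
    simpa using this
  rw [htr] at key
  simpa using (Complex.le_def.1 key).1

lemma aux_trace_eq {n : ℕ} (ρ : Matrix (Fin n) (Fin n) ℂ) (h : ρ.IsHermitian) :
    ((ρ * ρ).trace).re = ∑ i, ∑ j, Complex.normSq (ρ i j) := by
  simp only [Matrix.trace, Matrix.diag, Matrix.mul_apply, Complex.re_sum]
  refine Finset.sum_congr rfl fun i _ => Finset.sum_congr rfl fun j _ => ?_
  rw [← h.apply j i, Complex.star_def, Complex.mul_conj, Complex.ofReal_re]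

lemma aux_trace_pos {n : ℕ} (ρ : Matrix (Fin n) (Fin n) ℂ) (h : ρ.IsHermitian) (hne : ρ ≠ 0) :
    0 < ((ρ * ρ).trace).re := by
  rw [aux_trace_eq ρ h]
  by_contra hcon
  apply hne
  have h0 : ∑ i, ∑ j, Complex.normSq (ρ i j) = 0 :=
    le_antisymm (not_lt.1 hcon)
      (Finset.sum_nonneg fun i _ => Finset.sum_nonneg fun j _ => Complex.normSq_nonneg _)
  ext i j
  have h1 := (Finset.sum_eq_zero_iff_of_nonneg (fun i _ =>
    Finset.sum_nonneg fun j _ => Complex.normSq_nonneg (ρ i j))).1 h0 i (Finset.mem_univ _)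
  have h2 := (Finset.sum_eq_zero_iff_of_nonneg (fun j _ =>
    Complex.normSq_nonneg (ρ i j))).1 h1 j (Finset.mem_univ _)
  simpa using h2

lemma aux_real (a e d : ℝ) (hd : 0 < d) (ha : a ≤ 1) (hc : a + 2 * e + d ≤ 1)
    (hq : ∀ s : ℝ, 0 ≤ a + 2 * e * s + d * s ^ 2) (t : ℝ) (ht : t ∈ Set.Ioo (0 : ℝ) 1) :
    Real.log (1 + (a + 2 * e * t + d * t ^ 2)) <
      (1 - t) * Real.log (1 + a) + t * Real.log (1 + (a + 2 * e + d)) := by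
  have hder : ∀ s : ℝ, HasDerivAt (fun s => 1 + (a + 2 * e * s + d * s ^ 2))
      (2 * e + 2 * d * s) s := by
    intro s
    have h := ((((hasDerivAt_id s).const_mul (2 * e)).const_add a).add
      (((hasDerivAt_id s).pow 2).const_mul d)).const_add 1
    refine h.congr_deriv ?_
    simp
    ring
  have hpos : ∀ s : ℝ, 1 + (a + 2 * e * s + d * s ^ 2) ≠ 0 := fun s => by
    have := hq s
    positivity
  have h1 : deriv (fun s => Real.log (1 + (a + 2 * e * s + d * s ^ 2))) =
      fun s => (2 * e + 2 * d * s) / (1 + (a + 2 * e * s + d * s ^ 2)) :=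
    funext fun s => ((hder s).log (hpos s)).deriv
  have hder2 : ∀ s : ℝ, HasDerivAt (fun s => 2 * e + 2 * d * s) (2 * d) s := by
    intro s
    have h := ((hasDerivAt_id s).const_mul (2 * d)).const_add (2 * e)
    exact h.congr_deriv (by simp)
  have hdisc : e ^ 2 ≤ a * d := by
    have h := hq (-e / d)
    have h2 : a + 2 * e * (-e / d) + d * (-e / d) ^ 2 = (a * d - e ^ 2) / d := by
      field_simp
      ring
    rw [h2] at h
    have h3 := mul_nonneg h hd.le
    rw [div_mul_cancel₀ _ hd.ne'] at h3
    linarith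
  have hconv : StrictConvexOn ℝ (Set.Icc 0 1)
      (fun s => Real.log (1 + (a + 2 * e * s + d * s ^ 2))) := by
    apply strictConvexOn_of_deriv2_pos (convex_Icc 0 1)
    · intro s _
      exact ((hder s).log (hpos s)).continuousAt.continuousWithinAt
    · intro s hs
      rw [interior_Icc] at hs
      obtain ⟨hs0, hs1⟩ := hs
      simp only [Function.iterate_succ, Function.iterate_zero, Function.comp, id]
      rw [h1, ((hder2 s).fun_div (hder s) (hpos s)).deriv]
      apply div_pos _ (pow_pos (lt_of_le_of_ne (by linarith [hq s]) (hpos s).symm) 2)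
      have hlt : a + 2 * e * s + d * s ^ 2 < 1 := by
        nlinarith [mul_pos hd (mul_pos hs0 (sub_pos.2 hs1)),
          mul_le_mul_of_nonneg_left hc hs0.le,
          mul_le_mul_of_nonneg_left ha (sub_pos.2 hs1).le]
      nlinarith [mul_pos hd (sub_pos.2 hlt)]
  have := hconv.2 (Set.left_mem_Icc.2 zero_le_one) (Set.right_mem_Icc.2 zero_le_one)
    zero_ne_one (sub_pos.2 ht.2) ht.1 (by ring)
  simpa using this

/-- `Q₂` is strictly concave on the set of `n × n` density matrices: for distinct
density matrices `ρ₀ ≠ ρ₁` and `t ∈ (0,1)`,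
`Q₂((1-t)ρ₀ + tρ₁) > (1-t) Q₂(ρ₀) + t Q₂(ρ₁)`. -/
theorem stmt_6 (n : ℕ) (hn : 1 ≤ n) (ρ₀ ρ₁ : Matrix (Fin n) (Fin n) ℂ)
    (h₀ : ρ₀.PosSemidef) (h₀tr : ρ₀.trace = 1)
    (h₁ : ρ₁.PosSemidef) (h₁tr : ρ₁.trace = 1)
    (hne : ρ₀ ≠ ρ₁) (t : ℝ) (ht : t ∈ Set.Ioo (0 : ℝ) 1) :
    Q2 ((1 - t) • ρ₀ + t • ρ₁) > (1 - t) * Q2 ρ₀ + t * Q2 ρ₁ := by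
  have hH : ∀ s : ℝ, ((1 - s) • ρ₀ + s • ρ₁).IsHermitian := by
    intro s
    have e0 : ρ₀ᴴ = ρ₀ := h₀.1
    have e1 : ρ₁ᴴ = ρ₁ := h₁.1
    unfold Matrix.IsHermitian
    simp [Matrix.conjTranspose_add, Matrix.conjTranspose_smul, e0, e1]
  have hnn : ∀ ρ : Matrix (Fin n) (Fin n) ℂ, ρ.IsHermitian → 0 ≤ ((ρ * ρ).trace).re := by
    intro ρ h
    rw [aux_trace_eq ρ h]
    exact Finset.sum_nonneg fun i _ => Finset.sum_nonneg fun j _ => Complex.normSq_nonneg _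
  have hd := aux_trace_pos (ρ₁ - ρ₀) (h₁.1.sub h₀.1) (sub_ne_zero.2 hne.symm)
  set a := ((ρ₀ * ρ₀).trace).re with ha
  set e := ((ρ₀ * ρ₁).trace).re - a with he
  set d := (((ρ₁ - ρ₀) * (ρ₁ - ρ₀)).trace).re with hdd
  have hcomm : (ρ₁ * ρ₀).trace = (ρ₀ * ρ₁).trace := Matrix.trace_mul_comm _ _
  have hd2 : d = ((ρ₁ * ρ₁).trace).re - 2 * ((ρ₀ * ρ₁).trace).re + a := by
    rw [hdd, ha]
    simp only [Matrix.sub_mul, Matrix.mul_sub, Matrix.trace_sub, hcomm, Complex.sub_re]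
    ring
  have hexp : ∀ s : ℝ, ((((1 - s) • ρ₀ + s • ρ₁) * ((1 - s) • ρ₀ + s • ρ₁)).trace).re
      = a + 2 * e * s + d * s ^ 2 := by
    intro s
    rw [hd2, he]
    simp only [Matrix.add_mul, Matrix.mul_add, Matrix.trace_add, Matrix.smul_mul,
      Matrix.mul_smul, Matrix.trace_smul, hcomm, Complex.add_re, Complex.smul_re, smul_eq_mul]
    rw [← ha]
    ring
  have hc : ((ρ₁ * ρ₁).trace).re = a + 2 * e + d := by
    rw [hd2, he]; ring
  have hq : ∀ s : ℝ, 0 ≤ a + 2 * e * s + d * s ^ 2 := fun s => hexp s ▸ hnn _ (hH s)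
  have key := aux_real a e d hd (aux_trace_le ρ₀ h₀ h₀tr)
    (hc ▸ aux_trace_le ρ₁ h₁ h₁tr) hq t ht
  have ha0 : 0 ≤ a := hnn _ h₀.1
  have hc0 : 0 ≤ a + 2 * e + d := hc ▸ hnn _ h₁.1
  have ht0 := hq t
  unfold Q2
  rw [hexp t, hc, ← ha, Real.log_div two_ne_zero (by positivity),
    Real.log_div two_ne_zero (by positivity), Real.log_div two_ne_zero (by positivity)]
  nlinarith [key]
end

section
/- Let n ≥ 1 and let ρ₁, ρ₂ be n×n complex density matrices (Hermitian, positive semidefinite, trace 1), and let Q₂(ρ) = log(2 / (1 + Tr(ρ²))). Then for every λ ∈ [0,1], Q₂(λ ρ₁ + (1−λ) ρ₂) ≥ λ Q₂(ρ₁) + (1−λ) Q₂(ρ₂). -/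
open Matrix
open scoped ComplexOrder

lemma aux_nonneg {n : ℕ} (A : Matrix (Fin n) (Fin n) ℂ) (h : A.IsHermitian) :
    0 ≤ ((A * A).trace).re := by
  have h1 := (Matrix.posSemidef_conjTranspose_mul_self A).trace_nonneg
  rw [h.eq] at h1
  exact (Complex.le_def.1 h1).1

lemma aux_expand {n : ℕ} (A B : Matrix (Fin n) (Fin n) ℂ) (s t : ℝ) :
    (((s • A + t • B) * (s • A + t • B)).trace).re =
      s ^ 2 * ((A * A).trace).re + 2 * s * t * ((A * B).trace).re
        + t ^ 2 * ((B * B).trace).re := by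
  have h : (B * A).trace = (A * B).trace := Matrix.trace_mul_comm _ _
  simp only [add_mul, mul_add, smul_mul_assoc, mul_smul_comm, Matrix.trace_add,
    Matrix.trace_smul, Complex.add_re, Complex.smul_re, h, smul_eq_mul]
  ring

lemma aux_cs {n : ℕ} (A B : Matrix (Fin n) (Fin n) ℂ) (hA : A.IsHermitian)
    (hB : B.IsHermitian) :
    ((A * B).trace).re ≤ √((A * A).trace).re * √((B * B).trace).re := by
  rw [← Real.sqrt_mul (aux_nonneg A hA)]
  apply Real.le_sqrt_of_sq_le
  have hq : ∀ t : ℝ, 0 ≤ ((A * A).trace).re * (t * t) + (2 * ((A * B).trace).re) * t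
      + ((B * B).trace).re := by
    intro t
    have hH : (t • A + (1 : ℝ) • B).IsHermitian := by
      unfold Matrix.IsHermitian
      simp [Matrix.conjTranspose_add, Matrix.conjTranspose_smul, hA.eq, hB.eq]
    have := aux_nonneg _ hH
    rw [aux_expand] at this
    linarith
  have := discrim_le_zero hq
  unfold discrim at this
  linarith

lemma aux_le_one {n : ℕ} (A : Matrix (Fin n) (Fin n) ℂ) (h : A.PosSemidef)
    (ht : A.trace = 1) : ((A * A).trace).re ≤ 1 := by
  have key : ∀ i j, (A i j * A j i).re ≤ (A i i).re * (A j j).re := by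
    intro i j
    have h1 := (h.submatrix ![i, j]).det_nonneg
    rw [Matrix.det_fin_two] at h1
    have h2 := (Complex.le_def.1 h1).1
    have h3 : (A i i).im = 0 := by
      have := (Complex.le_def.1 (h.diag_nonneg (i := i))).2
      simpa using this.symm
    simp [h3] at h2
    simpa using h2
  have h2 : ∑ i, (A i i).re = 1 := by
    have := congrArg Complex.re ht
    simpa [Matrix.trace] using this
  calc ((A * A).trace).re = ∑ i, ∑ j, (A i j * A j i).re := by
        simp only [Matrix.trace, Matrix.diag, Matrix.mul_apply, Complex.re_sum]
    _ ≤ ∑ i, ∑ j, (A i i).re * (A j j).re :=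
        Finset.sum_le_sum fun i _ => Finset.sum_le_sum fun j _ => key i j
    _ = 1 := by rw [← Finset.sum_mul_sum, h2, one_mul]

lemma aux_convex : ConvexOn ℝ (Set.Icc (0 : ℝ) 1) (fun x => Real.log (1 + x ^ 2)) := by
  have hd : ∀ x : ℝ, HasDerivAt (fun x : ℝ => Real.log (1 + x ^ 2)) (2 * x / (1 + x ^ 2)) x := by
    intro x
    have h1 : HasDerivAt (fun x : ℝ => 1 + x ^ 2) (2 * x) x := by
      simpa using (hasDerivAt_pow 2 x).const_add 1
    exact h1.log (by positivity)
  apply MonotoneOn.convexOn_of_deriv (convex_Icc _ _)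
  · exact fun x _ => (hd x).continuousAt.continuousWithinAt
  · exact fun x _ => (hd x).differentiableAt.differentiableWithinAt
  · rw [interior_Icc]
    intro x hx y hy hxy
    rw [(hd x).deriv, (hd y).deriv, div_le_div_iff₀ (by positivity) (by positivity)]
    have h1 : x * y ≤ 1 := by nlinarith [hx.1, hx.2, hy.1, hy.2]
    nlinarith [mul_nonneg (sub_nonneg.2 hxy) (sub_nonneg.2 h1)]

/-- `Q₂` is concave: for density matrices `ρ₁, ρ₂` and `λ ∈ [0,1]`,
`Q₂(λρ₁ + (1-λ)ρ₂) ≥ λ Q₂(ρ₁) + (1-λ) Q₂(ρ₂)`. -/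
theorem stmt_7 (n : ℕ) (hn : 1 ≤ n) (ρ₁ ρ₂ : Matrix (Fin n) (Fin n) ℂ)
    (h₁ : ρ₁.PosSemidef) (h₁tr : ρ₁.trace = 1)
    (h₂ : ρ₂.PosSemidef) (h₂tr : ρ₂.trace = 1)
    (l : ℝ) (hl : l ∈ Set.Icc (0 : ℝ) 1) :
    Q2 (l • ρ₁ + (1 - l) • ρ₂) ≥ l * Q2 ρ₁ + (1 - l) * Q2 ρ₂ := by
  have a0 := aux_nonneg ρ₁ h₁.isHermitian
  have b0 := aux_nonneg ρ₂ h₂.isHermitian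
  have a1 := aux_le_one ρ₁ h₁ h₁tr
  have b1 := aux_le_one ρ₂ h₂ h₂tr
  have hc := aux_cs ρ₁ ρ₂ h₁.isHermitian h₂.isHermitian
  have hH : (l • ρ₁ + (1 - l) • ρ₂).IsHermitian := by
    unfold Matrix.IsHermitian
    simp [Matrix.conjTranspose_add, Matrix.conjTranspose_smul, h₁.isHermitian.eq,
      h₂.isHermitian.eq]
  have m0 := aux_nonneg _ hH
  unfold Q2
  rw [aux_expand] at m0 ⊢
  set a := ((ρ₁ * ρ₁).trace).re
  set b := ((ρ₂ * ρ₂).trace).re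
  set c := ((ρ₁ * ρ₂).trace).re
  obtain ⟨l0, l1⟩ := hl
  have hl' : 0 ≤ 1 - l := by linarith
  have hconv := aux_convex.2 (x := √a) ⟨Real.sqrt_nonneg _, Real.sqrt_le_one.2 a1⟩
    (y := √b) ⟨Real.sqrt_nonneg _, Real.sqrt_le_one.2 b1⟩ l0 hl' (by ring)
  simp only [smul_eq_mul, Real.sq_sqrt a0, Real.sq_sqrt b0] at hconv
  have hle : 1 + (l ^ 2 * a + 2 * l * (1 - l) * c + (1 - l) ^ 2 * b) ≤
      1 + (l * √a + (1 - l) * √b) ^ 2 := by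
    have e : (l * √a + (1 - l) * √b) ^ 2 =
        l ^ 2 * a + 2 * l * (1 - l) * (√a * √b) + (1 - l) ^ 2 * b := by
      linear_combination l ^ 2 * Real.sq_sqrt a0 + (1 - l) ^ 2 * Real.sq_sqrt b0
    rw [e]
    have := mul_le_mul_of_nonneg_left hc (mul_nonneg (mul_nonneg zero_le_two l0) hl')
    linarith
  have hlog := Real.log_le_log (by linarith) hle
  rw [Real.log_div two_ne_zero (by linarith), Real.log_div two_ne_zero (by linarith),
    Real.log_div two_ne_zero (by linarith)]
  linarith
end

section
/- Let n ≥ 1 and let ρ be an n×n complex density matrix (Hermitian, positive semidefinite, trace 1) whose eigenvalues λ₁, …, λₙ (with multiplicity) are pairwise distinct. Then −log( ∑_{i=1}^{n} λᵢ^{n+1} / ∏_{j ≠ i} (λᵢ − λⱼ) ) = log( 2 / (1 + Tr(ρ²)) ); i.e., the spectral expression ∑ᵢ λᵢ^{n+1}/∏_{j≠i}(λᵢ − λⱼ) equals (1 + Tr(ρ²))/2, a positive real number. -/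
open Matrix Finset
open scoped ComplexOrder

/-- The spectral sum over a finset. -/
noncomputable def spSum {ι : Type*} [DecidableEq ι] (v : ι → ℝ) (s : Finset ι) (k : ℕ) : ℝ :=
  ∑ i ∈ s, v i ^ k / ∏ j ∈ s.erase i, (v i - v j)

lemma spSum_insert {ι : Type*} [DecidableEq ι] (v : ι → ℝ) (hv : Function.Injective v)
    (s : Finset ι) (a : ι) (ha : a ∉ s) (k : ℕ) :
    spSum v (insert a s) (k + 1) = v a * spSum v (insert a s) k + spSum v s k := by
  unfold spSum
  rw [Finset.sum_insert ha, Finset.sum_insert ha, mul_add, Finset.mul_sum, add_assoc,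
    ← Finset.sum_add_distrib]
  congr 1
  · ring
  · refine Finset.sum_congr rfl fun i hi => ?_
    have hia : i ≠ a := fun h => ha (h ▸ hi)
    have hne : v i - v a ≠ 0 := sub_ne_zero.2 (hv.ne hia)
    have hP : ∏ j ∈ s.erase i, (v i - v j) ≠ 0 := by
      refine Finset.prod_ne_zero_iff.2 fun j hj => sub_ne_zero.2 (hv.ne ?_)
      exact (Finset.ne_of_mem_erase hj).symm
    rw [Finset.erase_insert_of_ne hia.symm, Finset.prod_insert (by simp [ha])]
    field_simp
    ring

lemma spSum_top {ι : Type*} [DecidableEq ι] (v : ι → ℝ) (hv : Function.Injective v)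
    (s : Finset ι) (m : ℕ) (hs : s.card = m + 1) : spSum v s m = 1 := by
  have h := Lagrange.leadingCoeff_eq_sum (s := s) (v := v) hv.injOn
    (P := (Polynomial.X : Polynomial ℝ) ^ m) (by simp [hs])
  simpa [spSum] using h.symm

lemma spSum_main {ι : Type*} [DecidableEq ι] (v : ι → ℝ) (hv : Function.Injective v)
    (s : Finset ι) : spSum v s s.card = ∑ i ∈ s, v i ∧
      spSum v s (s.card + 1) = ((∑ i ∈ s, v i) ^ 2 + ∑ i ∈ s, v i ^ 2) / 2 := by
  induction s using Finset.induction_on with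
  | empty => simp [spSum]
  | insert a s ha ih =>
    have h0 := spSum_top v hv (insert a s) s.card (Finset.card_insert_of_notMem ha)
    have h1 := spSum_insert v hv s a ha s.card
    have h2 := spSum_insert v hv s a ha (s.card + 1)
    rw [Finset.card_insert_of_notMem ha, Finset.sum_insert ha, Finset.sum_insert ha, h2, h1, h0,
      ih.1, ih.2]
    constructor <;> ring


/-- For a density matrix `ρ` with pairwise distinct eigenvalues `λ₁, …, λₙ`,
`−log(∑ᵢ λᵢ^(n+1) / ∏_{j≠i}(λᵢ − λⱼ)) = log(2/(1 + Tr ρ²))`; equivalently the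
spectral sum equals `(1 + Tr ρ²)/2`. -/
theorem stmt_16 (n : ℕ) (hn : 1 ≤ n) (ρ : Matrix (Fin n) (Fin n) ℂ)
    (hρ : ρ.PosSemidef) (hρtr : ρ.trace = 1)
    (hdist : Function.Injective hρ.1.eigenvalues) :
    ∑ i, hρ.1.eigenvalues i ^ (n + 1) /
        ∏ j ∈ Finset.univ.erase i, (hρ.1.eigenvalues i - hρ.1.eigenvalues j)
      = (1 + ((ρ * ρ).trace).re) / 2 ∧
    -Real.log (∑ i, hρ.1.eigenvalues i ^ (n + 1) /
        ∏ j ∈ Finset.univ.erase i, (hρ.1.eigenvalues i - hρ.1.eigenvalues j))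
      = Real.log (2 / (1 + ((ρ * ρ).trace).re)) := by
  have h1 : ∑ i, hρ.1.eigenvalues i = 1 := by
    have h := hρ.1.trace_eq_sum_eigenvalues
    rw [hρtr] at h
    have h' : (1 : ℂ) = ∑ i, ((hρ.1.eigenvalues i : ℝ) : ℂ) := h
    exact_mod_cast h'.symm
  have h2 : ((ρ * ρ).trace).re = ∑ i, hρ.1.eigenvalues i ^ 2 := by
    have h : (ρ * ρ).trace = ∑ i, ((hρ.1.eigenvalues i : ℂ)) ^ 2 := by
      conv_lhs => rw [hρ.1.spectral_theorem, ← map_mul, Unitary.conjStarAlgAut_apply,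
        Matrix.trace_mul_cycle]
      simp [Matrix.trace, Matrix.diagonal_mul_diagonal, pow_two]
    rw [h]
    norm_cast
  have h3 := (spSum_main _ hdist Finset.univ).2
  rw [Finset.card_univ, Fintype.card_fin, h1, ← h2, one_pow] at h3
  unfold spSum at h3
  refine ⟨h3, ?_⟩
  rw [h3, ← Real.log_inv, inv_div]
end
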